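/- Let n ≥ 2, let u ∈ ℝⁿ be unit timelike, and let F be an antisymmetric real n×n matrix (a Maxwell-like covariant rank-2 tensor). Then F is minimal with respect to u if and only if (ηF)(ηF)u is a scalar multiple of u, i.e., if and only if u is an eigenvector of the mixed operator (ηF)². -/

import Mathlib

open Matrix

noncomputable section

/-- The Minkowski metric `η = diag(-1, 1, …, 1)` on `ℝⁿ`. -/
def eta (n : ℕ) : Matrix (Fin n) (Fin n) ℝ :=
  Matrix.diagonal fun i => if i.val = 0 then (-1 : ℝ) else 1

/-- The Lorentz group `O(1,n-1)`: matrices with `Λᵀ η Λ = η`. -/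
def IsLorentz {n : ℕ} (Λ : Matrix (Fin n) (Fin n) ℝ) : Prop :=
  Λᵀ * eta n * Λ = eta n

/-- `G_u = η + 2uuᵀ`. -/
def Gmat {n : ℕ} (u : Fin n → ℝ) : Matrix (Fin n) (Fin n) ℝ :=
  eta n + (2 : ℝ) • vecMulVec u u

/-- The Euclidean norm associated with `u` on `n×n` matrices:
`‖A‖_u = √(tr(G_u A G_u Aᵀ))`. -/
def matNorm {n : ℕ} (u : Fin n → ℝ) (A : Matrix (Fin n) (Fin n) ℝ) : ℝ :=
  Real.sqrt (Matrix.trace (Gmat u * A * Gmat u * Aᵀ))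

/-- A matrix `A` (covariant rank-2 tensor) is minimal with respect to `u` if
`‖ΛᵀAΛ‖_u ≥ ‖A‖_u` for every Lorentz `Λ`. -/
def IsMinimalMat {n : ℕ} (u : Fin n → ℝ) (A : Matrix (Fin n) (Fin n) ℝ) : Prop :=
  ∀ Λ : Matrix (Fin n) (Fin n) ℝ, IsLorentz Λ → matNorm u A ≤ matNorm u (Λᵀ * A * Λ)

/-! Helper lemmas -/

lemma eta_T (n : ℕ) : (eta n)ᵀ = eta n := by simp [eta]

lemma eta_sq (n : ℕ) : eta n * eta n = 1 := by
  rw [eta, diagonal_mul_diagonal, ← diagonal_one]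
  congr 1; funext i; split_ifs <;> simp

/-- `xᵀ η y` -/
def bil {n : ℕ} (x y : Fin n → ℝ) : ℝ := x ⬝ᵥ (eta n).mulVec y

lemma bil_comm {n : ℕ} (x y : Fin n → ℝ) : bil x y = bil y x := by
  unfold bil
  rw [dotProduct_mulVec, ← mulVec_transpose, eta_T, dotProduct_comm]

lemma bil_add_left {n : ℕ} (x y z : Fin n → ℝ) : bil (x + y) z = bil x z + bil y z := by
  simp [bil, add_dotProduct]
lemma bil_add_right {n : ℕ} (x y z : Fin n → ℝ) : bil x (y + z) = bil x y + bil x z := by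
  simp [bil, mulVec_add, dotProduct_add]
lemma bil_smul_left {n : ℕ} (a : ℝ) (x z : Fin n → ℝ) : bil (a • x) z = a * bil x z := by
  simp [bil]
lemma bil_smul_right {n : ℕ} (a : ℝ) (x z : Fin n → ℝ) : bil x (a • z) = a * bil x z := by
  simp [bil, mulVec_smul]

lemma bil_eta {n : ℕ} (x y : Fin n → ℝ) : bil x ((eta n).mulVec y) = x ⬝ᵥ y := by
  simp [bil, mulVec_mulVec, eta_sq]

lemma dot_F {n : ℕ} (F : Matrix (Fin n) (Fin n) ℝ) (hF : Fᵀ = -F) (x y : Fin n → ℝ) :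
    x ⬝ᵥ F.mulVec y = - (y ⬝ᵥ F.mulVec x) := by
  rw [dotProduct_mulVec, ← mulVec_transpose, hF, neg_mulVec, neg_dotProduct, dotProduct_comm]

/-- the form `η + uuᵀ` is positive semidefinite -/
lemma P_nonneg {n : ℕ} (u : Fin n → ℝ) (hu : bil u u = -1) (x : Fin n → ℝ) :
    0 ≤ bil x x + (u ⬝ᵥ x) ^ 2 := by
  cases n with
  | zero => simp [bil] at hu
  | succ m =>
    simp only [bil, eta, mulVec_diagonal, dotProduct, Fin.sum_univ_succ, Fin.val_zero, if_true,
      Fin.val_succ, Nat.succ_ne_zero, if_false, one_mul, Nat.add_eq_zero_iff, one_ne_zero,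
      and_false] at hu ⊢
    have hcs := Finset.sum_mul_sq_le_sq_mul_sq Finset.univ (fun i : Fin m => u i.succ)
      (fun i => x i.succ)
    simp only [sq] at hcs
    have ha : 0 ≤ ∑ i : Fin m, u i.succ * u i.succ :=
      Finset.sum_nonneg fun i _ => mul_self_nonneg _
    have hr : 0 ≤ ∑ i : Fin m, x i.succ * x i.succ :=
      Finset.sum_nonneg fun i _ => mul_self_nonneg _
    generalize (∑ i : Fin m, u i.succ * u i.succ) = a at *
    generalize (∑ i : Fin m, x i.succ * x i.succ) = r at *
    generalize (∑ i : Fin m, u i.succ * x i.succ) = p at *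
    generalize u 0 = u0 at *
    generalize x 0 = x0 at *
    have hu0 : u0 * u0 = 1 + a := by linarith
    rcases ha.eq_or_lt with h | h
    · subst h
      have : p = 0 := by nlinarith
      subst this
      nlinarith
    · have : 0 ≤ a * (x0 * (-1 * x0) + r + (u0 * x0 + p) ^ 2) := by
        have : a * (x0 * (-1 * x0) + r + (u0 * x0 + p) ^ 2)
          = (a * x0 + u0 * p) ^ 2 + (a * r - p * p) := by
          linear_combination (a * x0 ^ 2 - p ^ 2) * hu0
        rw [this]; nlinarith [sq_nonneg (a * x0 + u0 * p)]
      exact nonneg_of_mul_nonneg_right this h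

lemma P_cs {n : ℕ} (u : Fin n → ℝ) (hu : bil u u = -1) (x y : Fin n → ℝ)
    (hx : u ⬝ᵥ x = 0) (hy : u ⬝ᵥ y = 0) : (bil x y) ^ 2 ≤ bil x x * bil y y := by
  have h : ∀ t : ℝ, 0 ≤ bil y y * (t * t) + (2 * bil x y) * t + bil x x := by
    intro t
    have := P_nonneg u hu (x + t • y)
    simp only [bil_add_left, bil_add_right, bil_smul_left, bil_smul_right, dotProduct_add,
      dotProduct_smul, hx, hy, bil_comm y x] at this
    simp at this
    linarith
  have := discrim_le_zero h
  unfold discrim at this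
  nlinarith

lemma dot_eq_trace {n : ℕ} (a b : Fin n → ℝ) (M : Matrix (Fin n) (Fin n) ℝ) :
    trace (vecMulVec a b * M) = b ⬝ᵥ M.mulVec a := by
  rw [vecMulVec_mul, trace_vecMulVec, dotProduct_mulVec, dotProduct_comm]

lemma trace_G {n : ℕ} (F : Matrix (Fin n) (Fin n) ℝ) (hF : Fᵀ = -F) (v : Fin n → ℝ) :
    trace (Gmat v * F * Gmat v * Fᵀ) =
      trace (eta n * F * eta n * Fᵀ) + 4 * bil (F.mulVec v) (F.mulVec v) := by
  have h1 : v ⬝ᵥ F.mulVec v = 0 := by have := dot_F F hF v v; linarith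
  have e : Gmat v * F * Gmat v * Fᵀ = eta n * F * eta n * Fᵀ
      + (2 : ℝ) • (vecMulVec v v * (F * eta n * Fᵀ))
      + (2 : ℝ) • (eta n * (F * (vecMulVec v v * Fᵀ)))
      + (4 : ℝ) • (vecMulVec v v * (F * (vecMulVec v v * Fᵀ))) := by
    simp only [Gmat, add_mul, mul_add, smul_mul_assoc, mul_smul_comm, smul_smul, smul_add,
      Matrix.mul_assoc]
    norm_num
    abel
  have e2 : F * (vecMulVec v v * Fᵀ) = vecMulVec (F.mulVec v) (F.mulVec v) := by
    rw [vecMulVec_mul, mul_vecMulVec, vecMul_transpose]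
  rw [e, e2]
  simp only [trace_add, trace_smul, dot_eq_trace]
  rw [Matrix.trace_mul_comm (eta n), dot_eq_trace, ← mulVec_mulVec, ← mulVec_mulVec,
    dot_F F hF v, hF, neg_mulVec]
  have : vecMulVec (F.mulVec v) (F.mulVec v) *ᵥ v = 0 := by
    rw [vecMulVec_mulVec, dotProduct_comm, h1]; simp
  rw [this]
  have h2 : (eta n *ᵥ F *ᵥ v) ⬝ᵥ F *ᵥ v = bil (F *ᵥ v) (F *ᵥ v) := by
    rw [dotProduct_comm]; rfl
  simp only [mulVec_neg, neg_dotProduct, smul_eq_mul, dotProduct_zero, h2]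
  rw [show F *ᵥ v ⬝ᵥ eta n *ᵥ F *ᵥ v = bil (F *ᵥ v) (F *ᵥ v) from rfl]
  ring

lemma conj_G {n : ℕ} (Λ : Matrix (Fin n) (Fin n) ℝ) (h : IsLorentz Λ) (u : Fin n → ℝ) :
    Λ * Gmat u * Λᵀ = Gmat (Λ.mulVec u) := by
  have h1 : (eta n * Λᵀ * eta n) * Λ = 1 := by
    unfold IsLorentz at h
    rw [← eta_sq n]
    nth_rw 4 [← h]
    simp only [Matrix.mul_assoc]
  have h2 := mul_eq_one_comm.mp h1
  have h3 : Λ * eta n * Λᵀ = eta n := by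
    calc Λ * eta n * Λᵀ = (Λ * (eta n * Λᵀ * eta n)) * eta n := by
          simp only [Matrix.mul_assoc, eta_sq, Matrix.mul_one]
      _ = eta n := by rw [h2, Matrix.one_mul]
  rw [Gmat, mul_add, add_mul, h3, Gmat, mul_smul_comm, smul_mul_assoc, mul_vecMulVec,
    vecMulVec_mul, vecMul_transpose]

lemma trace_L {n : ℕ} (F : Matrix (Fin n) (Fin n) ℝ) (hF : Fᵀ = -F)
    (Λ : Matrix (Fin n) (Fin n) ℝ) (h : IsLorentz Λ) (u : Fin n → ℝ) :
    trace (Gmat u * (Λᵀ * F * Λ) * Gmat u * (Λᵀ * F * Λ)ᵀ) =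
      trace (eta n * F * eta n * Fᵀ) + 4 * bil (F.mulVec (Λ.mulVec u)) (F.mulVec (Λ.mulVec u)) := by
  rw [← trace_G F hF, ← conj_G Λ h, transpose_mul, transpose_mul, transpose_transpose]
  have : Gmat u * (Λᵀ * F * Λ) * Gmat u * (Λᵀ * (Fᵀ * Λ)) =
    (Gmat u * Λᵀ * F * Λ * Gmat u * Λᵀ * Fᵀ) * Λ := by simp only [Matrix.mul_assoc]
  rw [this, trace_mul_comm]
  simp only [Matrix.mul_assoc]

lemma G_psd {n : ℕ} (u : Fin n → ℝ) (hu : bil u u = -1) : (Gmat u).PosSemidef := by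
  refine PosSemidef.of_dotProduct_mulVec_nonneg ?_ ?_
  · show (Gmat u)ᴴ = _
    rw [conjTranspose_eq_transpose_of_trivial]
    simp [Gmat, eta_T, transpose_vecMulVec]
  · intro x
    have := P_nonneg u hu x
    have e : star x ⬝ᵥ Gmat u *ᵥ x = bil x x + 2 * (u ⬝ᵥ x) ^ 2 := by
      simp [Gmat, add_mulVec, bil, dotProduct_add, smul_mulVec, vecMulVec_mulVec, dotProduct_comm x u]
      ring
    rw [e]; nlinarith [sq_nonneg (u ⬝ᵥ x)]

lemma trace_nonneg' {n : ℕ} (u : Fin n → ℝ) (hu : bil u u = -1) (A : Matrix (Fin n) (Fin n) ℝ) :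
    0 ≤ trace (Gmat u * A * Gmat u * Aᵀ) := by
  have hG := G_psd u hu
  have hM : (A * Gmat u * Aᵀ).PosSemidef := by
    have := hG.mul_mul_conjTranspose_same A
    rwa [conjTranspose_eq_transpose_of_trivial] at this
  obtain ⟨m, v, hv⟩ := Matrix.posSemidef_iff_eq_sum_vecMulVec.mp hG
  rw [Matrix.mul_assoc, Matrix.mul_assoc, ← Matrix.mul_assoc A]
  generalize A * Gmat u * Aᵀ = M at hM
  rw [hv, Finset.sum_mul, trace_sum]
  refine Finset.sum_nonneg fun i _ => ?_
  rw [dot_eq_trace]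
  exact hM.dotProduct_mulVec_nonneg _

/-- reflections -/
lemma refl_lorentz {n : ℕ} (z : Fin n → ℝ) (hz : bil z z ≠ 0) :
    IsLorentz (1 - (2 / bil z z) • vecMulVec z ((eta n).mulVec z)) := by
  unfold IsLorentz
  set w := (eta n).mulVec z with hw
  have hzw : z ⬝ᵥ w = bil z z := rfl
  have h1 : vecMulVec w z * eta n = vecMulVec w w := by
    rw [vecMulVec_mul, ← mulVec_transpose, eta_T]
  have h2 : eta n * vecMulVec z w = vecMulVec w w := by rw [mul_vecMulVec]
  have h3 : vecMulVec w w * vecMulVec z w = bil z z • vecMulVec w w := by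
    rw [vecMulVec_mul_vecMulVec, dotProduct_comm, hzw]
    ext i j; simp [vecMulVec_apply]; try ring
  rw [transpose_sub, transpose_one, transpose_smul, transpose_vecMulVec]
  simp only [sub_mul, mul_sub, Matrix.one_mul, Matrix.mul_one, smul_mul_assoc, mul_smul_comm, h1, h2, h3,
    smul_smul]
  have : 2 / bil z z * (2 / bil z z * bil z z) = 2 / bil z z + 2 / bil z z := by
    field_simp; norm_num
  have e : ∀ (c : ℝ) (M E : Matrix (Fin n) (Fin n) ℝ), E - c • M - (c • M - (c + c) • M) = E := by
    intro c M E; rw [add_smul]; abel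
  rw [smul_sub, smul_smul, this, e]

lemma refl_apply {n : ℕ} (z u : Fin n → ℝ) :
    (1 - (2 / bil z z) • vecMulVec z ((eta n).mulVec z)).mulVec u
      = u - (2 / bil z z * bil z u) • z := by
  have : eta n *ᵥ z ⬝ᵥ u = bil z u := by rw [dotProduct_comm, bil_comm]; rfl
  rw [sub_mulVec, one_mulVec, smul_mulVec, vecMulVec_mulVec, this]
  ext i; simp; ring

lemma poly_arg (b k s : ℝ) (hs : 0 ≤ s)
    (h : ∀ e : ℝ, e ^ 2 * s ≠ 1 → 0 ≤ e ^ 2 * k + e * (1 + e ^ 2 * s) * b) : b = 0 := by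
  by_contra hb
  have hb2 : 0 < b ^ 2 := by positivity
  have hD : 0 < 1 + |k| + b ^ 2 * s := by positivity
  obtain ⟨d, hd⟩ : ∃ d, d = 1 / (1 + |k| + b ^ 2 * s) := ⟨_, rfl⟩
  have hd0 : 0 < d := by rw [hd]; positivity
  have hd1 : d * (1 + |k| + b ^ 2 * s) = 1 := by rw [hd]; field_simp
  have hbs : 0 ≤ b ^ 2 * s := by positivity
  have hk := abs_nonneg k
  have hk' := le_abs_self k
  have hdk : d * k ≤ d * |k| := by gcongr
  have hdk0 : 0 ≤ d * |k| := by positivity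
  have hdb : 0 ≤ d * (b ^ 2 * s) := by positivity
  have hdle : d ≤ 1 := by nlinarith
  have hlt : d * (d * (b ^ 2 * s)) < 1 := by nlinarith
  have := h (-b * d) (by intro h'; nlinarith)
  have e : (-b * d) ^ 2 * k + -b * d * (1 + (-b * d) ^ 2 * s) * b
    = (d * b ^ 2) * (d * k - 1 - d * (d * (b ^ 2 * s))) := by ring
  rw [e] at this
  have h4 := nonneg_of_mul_nonneg_right this (by positivity)
  nlinarith

/-- `bil (F x) (F y)`, in terms of the operator. -/
lemma bilF {n : ℕ} (F : Matrix (Fin n) (Fin n) ℝ) (hF : Fᵀ = -F) (x y : Fin n → ℝ) :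
    bil (F.mulVec x) (F.mulVec y) = - bil y (((eta n * F) * (eta n * F)).mulVec x) := by
  have h : eta n *ᵥ (((eta n * F) * (eta n * F)).mulVec x) = F *ᵥ (eta n *ᵥ F *ᵥ x) := by
    rw [mulVec_mulVec, mulVec_mulVec, mulVec_mulVec]
    congr 1
    rw [Matrix.mul_assoc (eta n) F, ← Matrix.mul_assoc (eta n) (eta n), eta_sq, Matrix.one_mul,
      Matrix.mul_assoc]
  rw [bil_comm, bil, bil, h, dot_F F hF y, neg_neg, dotProduct_comm]

/-- An antisymmetric (Maxwell-like) matrix `F` is minimal with respect to a unit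
timelike `u` iff `u` is an eigenvector of the mixed operator `(ηF)²`. -/
theorem stmt3 {n : ℕ} (hn : 2 ≤ n) (u : Fin n → ℝ)
    (hu : u ⬝ᵥ (eta n).mulVec u = -1)
    (F : Matrix (Fin n) (Fin n) ℝ) (hF : Fᵀ = -F) :
    IsMinimalMat u F ↔
      ∃ c : ℝ, ((eta n * F) * (eta n * F)).mulVec u = c • u := by
  change bil u u = -1 at hu
  have huF : u ⬝ᵥ F.mulVec u = 0 := by have := dot_F F hF u u; linarith
  constructor
  · intro hmin
    have hq : ∀ Λ : Matrix (Fin n) (Fin n) ℝ, IsLorentz Λ →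
        bil (F.mulVec u) (F.mulVec u) ≤ bil (F.mulVec (Λ.mulVec u)) (F.mulVec (Λ.mulVec u)) := by
      intro Λ hΛ
      have := hmin Λ hΛ
      unfold matNorm at this
      rw [Real.sqrt_le_sqrt_iff (trace_nonneg' u hu _), trace_L F hF Λ hΛ, trace_G F hF] at this
      linarith
    have key : ∀ w, bil u w = 0 → bil (F.mulVec u) (F.mulVec w) = 0 := by
      intro w hw
      have hs : 0 ≤ bil w w := by
        have := P_nonneg u hu ((eta n).mulVec w)
        rw [bil_eta] at this
        change bil u w = 0 at hw
        rw [show u ⬝ᵥ eta n *ᵥ w = 0 from hw, dotProduct_comm] at this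
        simpa [bil] using this
      refine poly_arg _ (bil w w * bil (F.mulVec u) (F.mulVec u) + bil (F.mulVec w) (F.mulVec w))
        (bil w w) hs ?_
      intro e he
      have hzz : bil (u + e • w) (u + e • w) = e ^ 2 * bil w w - 1 := by
        simp only [bil_add_left, bil_add_right, bil_smul_left, bil_smul_right, hu, hw, bil_comm w u]
        ring
      have hzu : bil (u + e • w) u = -1 := by
        simp only [bil_add_left, bil_smul_left, hu, hw, bil_comm w u]; ring
      have hne : e ^ 2 * bil w w - 1 ≠ 0 := sub_ne_zero.mpr he
      have h1 := hq _ (refl_lorentz (u + e • w) (by rw [hzz]; exact hne))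
      rw [refl_apply, hzz, hzu] at h1
      have hv : u - (2 / (e ^ 2 * bil w w - 1) * -1) • (u + e • w)
          = (1 / (e ^ 2 * bil w w - 1)) • ((1 + e ^ 2 * bil w w) • u + (2 * e) • w) := by
        ext i; simp; field_simp; ring
      rw [hv] at h1
      simp only [mulVec_smul, mulVec_add, bil_add_left, bil_add_right, bil_smul_left,
        bil_smul_right, bil_comm (F.mulVec w) (F.mulVec u)] at h1
      set D := e ^ 2 * bil w w - 1 with hD
      have hD2 : 0 < D ^ 2 := by positivity
      have h2 := mul_le_mul_of_nonneg_left h1 hD2.le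
      have h3 : ∀ X A B Y : ℝ, D ^ 2 * (1 / D * (A * (1 / D * X) + B * (1 / D * Y)))
          = A * X + B * Y := by intro X A B Y; field_simp
      rw [h3, hD] at h2
      nlinarith
    refine ⟨bil (F.mulVec u) (F.mulVec u), ?_⟩
    set q := bil (F.mulVec u) (F.mulVec u) with hqd
    set T := ((eta n * F) * (eta n * F)).mulVec u with hT
    have hall : ∀ y, bil y T = bil y (q • u) := by
      intro y
      have h1 := key (y + (bil u y) • u) (by rw [bil_add_right, bil_smul_right, hu]; ring)
      rw [mulVec_add, mulVec_smul, bil_add_right, bil_smul_right, bilF F hF u y, ← hqd] at h1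
      rw [bil_smul_right, bil_comm y u]
      linarith
    apply dotProduct_eq
    intro y
    have := hall ((eta n).mulVec y)
    rwa [bil_comm, bil_eta, bil_comm, bil_eta] at this
  · rintro ⟨c, hc⟩ Λ hΛ
    unfold matNorm
    apply Real.sqrt_le_sqrt
    rw [trace_L F hF Λ hΛ, trace_G F hF]
    have hv : bil (Λ.mulVec u) (Λ.mulVec u) = -1 := by
      rw [← hu, bil, bil, dotProduct_comm, dotProduct_mulVec, ← mulVec_transpose, dotProduct_comm,
        mulVec_mulVec, mulVec_mulVec, hΛ]
    set v := Λ.mulVec u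
    have hFu : ∀ y, bil (F.mulVec u) (F.mulVec y) = - c * bil u y := by
      intro y; rw [bilF F hF, hc, bil_smul_right, bil_comm]; ring
    obtain ⟨a, w, hvw, hw⟩ : ∃ (a : ℝ) (w : Fin n → ℝ), v = a • u + w ∧ bil u w = 0 := by
      refine ⟨-bil u v, v + bil u v • u, ?_, ?_⟩
      · ext i; simp
      · rw [bil_add_right, bil_smul_right, hu]; ring
    have hcs := P_cs u hu (F.mulVec u) ((eta n).mulVec w) huF hw
    rw [bil_eta, hFu, hu, bil_eta, dotProduct_comm _ w, dot_F F hF w u,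
      dotProduct_comm _ w] at hcs
    change _ ≤ _ * bil w w at hcs
    have hP := P_nonneg u hu (F.mulVec w)
    rw [hvw] at hv ⊢
    simp only [mulVec_add, mulVec_smul, bil_add_left, bil_add_right, bil_smul_left, bil_smul_right,
      bil_comm (F.mulVec w) (F.mulVec u), bil_comm w u, hFu, hu, hw] at hv ⊢
    have ha : c * a ^ 2 = c + c * bil w w := by linear_combination (-c) * hv
    nlinarith

end
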